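/- arXiv:1402.5118 — 2 statements merged into one kernel-verified Lean document; each statement's English description precedes it below -/
import Mathlib

section
/- For all integers d ≥ 2 and j ≥ 1, the integer ∑_{i ∣ j} μ(i)·d^{j/i} (sum over positive divisors i of j) is strictly positive. (This guarantees that the formula dim V_j = (1/j)·∑_{i ∣ j} μ(i)·d^{j/i} gives a positive dimension for every graded piece of the free nilpotent Lie algebra on d ≥ 2 generators.) -/
/-- For `d ≥ 2` and `j ≥ 1`, the integer `∑_{i ∣ j} μ(i) d^(j/i)` is strictly positive. -/
theorem sum_moebius_pow_pos (d j : ℕ) (hd : 2 ≤ d) (hj : 1 ≤ j) :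
    0 < ∑ i ∈ j.divisors, ArithmeticFunction.moebius i * (d : ℤ) ^ (j / i) := by
  have reindex : ∑ i ∈ j.divisors, ArithmeticFunction.moebius i * (d : ℤ) ^ (j / i) =
      ∑ i ∈ j.divisors, ArithmeticFunction.moebius (j / i) * (d : ℤ) ^ i := by
    rw [← Nat.sum_div_divisors]
    refine Finset.sum_congr rfl fun i hi => ?_
    rw [Nat.div_div_self (Nat.dvd_of_mem_divisors hi) (by omega)]
  have geom : ∑ i ∈ j.properDivisors, (d : ℤ) ^ i < (d : ℤ) ^ j := by
    exact_mod_cast Nat.geomSum_lt hd fun i hi => (Nat.mem_properDivisors.1 hi).2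
  have lower : -∑ i ∈ j.properDivisors, (d : ℤ) ^ i ≤
      ∑ i ∈ j.properDivisors, ArithmeticFunction.moebius (j / i) * (d : ℤ) ^ i := by
    rw [← Finset.sum_neg_distrib]
    refine Finset.sum_le_sum fun i _ => ?_
    rw [neg_eq_neg_one_mul]
    gcongr
    exact (abs_le.1 ArithmeticFunction.abs_moebius_le_one).1
  rw [reindex, ← Nat.cons_self_properDivisors (by omega), Finset.sum_cons,
    Nat.div_self (by omega), ArithmeticFunction.moebius_apply_one, one_mul]
  linarith
end

section
/- Let d ≥ 1 and let Ω be a real skew-symmetric d × d matrix (Ωᵀ = −Ω). For a real number T, define the d × d matrix M(T) := ∑_{n=0}^{∞} (B_n(1/2)/n!) · Tⁿ · Ωⁿ, where B_n denotes the n-th Bernoulli polynomial; this series converges for |T|·‖Ω‖ < 2π and realizes the matrix function T·Ω/(2·sinh(T·Ω/2)) appearing in the paper. Then, as T → 0, √(det M(T)) = 1 + (T²/24)·∑_{1 ≤ i < j ≤ d} (Ω_{ij})² + o(T²); equivalently, ( √(det M(T)) − 1 ) / T² converges to (1/48)·∑_{i,j} (Ω_{ij})² = −(1/48)·tr(Ω²)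 as T → 0. (This is the computation by which the paper derives, from the closed formula H_T = det(TΩ/(2 sinh(TΩ/2)))^{1/2} valid in the two-step nilpotent case, the small-time asymptotics (H_T f − f)/T² → (1/24)·∑_{i<j} [V_i,V_j]² f.) -/
open Filter Matrix

/-- The matrix function `T ↦ T·Ω / (2 sinh (T·Ω / 2))`, realized via the power series
`∑_{n≥0} (B_n(1/2)/n!) Tⁿ Ωⁿ`, where `B_n` is the `n`-th Bernoulli polynomial (recall
`t/(2 sinh (t/2)) = t e^{t/2}/(e^t - 1) = ∑_{n≥0} B_n(1/2) tⁿ/n!` for `|t| < 2π`). -/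
noncomputable def sinhQuotientMatrix {d : ℕ} (Ω : Matrix (Fin d) (Fin d) ℝ) (T : ℝ) :
    Matrix (Fin d) (Fin d) ℝ :=
  ∑' n : ℕ, ((((Polynomial.bernoulli n).eval (1 / 2) : ℚ) : ℝ) / (n.factorial : ℝ)) •
    (T ^ n • Ω ^ n)

theorem Polynomial.eval_bernoulli_div_factorial (n : ℕ) (x : ℚ) :
    (Polynomial.bernoulli n).eval x / n.factorial = x ^ n / n.factorial -
      ∑ k ∈ Finset.range n,
        (Polynomial.bernoulli k).eval x / k.factorial / (n + 1 - k).factorial := by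
  have h := congrArg (Polynomial.eval x) (Polynomial.sum_bernoulli n)
  rw [Finset.sum_range_succ] at h
  simp only [Polynomial.eval_add, Polynomial.eval_finsetSum, Polynomial.eval_smul, smul_eq_mul,
    Polynomial.eval_monomial, Nat.choose_succ_self_right] at h
  have hf : ((n + 1).factorial : ℚ) ≠ 0 := by positivity
  have key : ∀ k ∈ Finset.range n,
      (Polynomial.bernoulli k).eval x / k.factorial / (n + 1 - k).factorial =
        ((n + 1).choose k : ℚ) * (Polynomial.bernoulli k).eval x / (n + 1).factorial := by
    intro k hk
    rw [Nat.cast_choose ℚ (by have := Finset.mem_range.mp hk; omega : k ≤ n + 1)]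
    field_simp
  rw [Finset.sum_congr rfl key, ← Finset.sum_div, eq_sub_of_add_eq h, Nat.factorial_succ]
  push_cast
  field_simp
  ring

theorem Polynomial.abs_eval_half_bernoulli_div_factorial_le (n : ℕ) :
    |(Polynomial.bernoulli n).eval (1 / 2 : ℚ) / n.factorial| ≤ 2 ^ n := by
  induction n using Nat.strong_induction_on with
  | _ n ih =>
    rw [Polynomial.eval_bernoulli_div_factorial]
    have h1 : |(1 / 2 : ℚ) ^ n / n.factorial| ≤ 1 := by
      rw [abs_of_nonneg (by positivity)]
      exact div_le_one_of_le₀ ((pow_le_one₀ (by norm_num) (by norm_num)).trans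
        (by exact_mod_cast n.factorial_pos)) (by positivity)
    have h2 : |∑ k ∈ Finset.range n, (Polynomial.bernoulli k).eval (1 / 2 : ℚ) / k.factorial /
        (n + 1 - k).factorial| ≤ ∑ k ∈ Finset.range n, (2 : ℚ) ^ k / 2 := by
      refine (Finset.abs_sum_le_sum_abs _ _).trans (Finset.sum_le_sum fun k hk => ?_)
      have hk := Finset.mem_range.mp hk
      rw [abs_div, Nat.abs_cast]
      have : 2 ≤ (n + 1 - k).factorial :=
        (by omega : 2 ≤ n + 1 - k).trans (Nat.self_le_factorial _)
      exact div_le_div₀ (by positivity) (ih k hk) (by norm_num) (by exact_mod_cast this)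
    rw [← Finset.sum_div, geom_sum_eq (by norm_num)] at h2
    have h3 : (1 : ℚ) ≤ 2 ^ n := one_le_pow₀ (by norm_num)
    have := abs_sub ((1 / 2 : ℚ) ^ n / n.factorial) (∑ k ∈ Finset.range n,
      (Polynomial.bernoulli k).eval (1 / 2 : ℚ) / k.factorial / (n + 1 - k).factorial)
    linarith

/-- First-order expansion of the determinant at the identity along a filter. -/
theorem Matrix.tendsto_det_one_add_sub_one_div {n α : Type*} [Fintype n] [DecidableEq n]
    {l : Filter α} {s : α → ℝ} {N : α → Matrix n n ℝ} {B : Matrix n n ℝ}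
    (hs : Tendsto s l (nhdsWithin 0 {0}ᶜ)) (hN : Tendsto N l (nhds B)) :
    Tendsto (fun a => ((1 + s a • N a).det - 1) / s a) l (nhds B.trace) := by
  have hs0 : Tendsto s l (nhds 0) := hs.mono_right nhdsWithin_le_nhds
  have hne : ∀ᶠ a in l, s a ≠ 0 := hs.eventually self_mem_nhdsWithin
  have hq (A : Matrix n n ℝ) (r : ℝ) :
      (det (1 + (Polynomial.X : Polynomial ℝ) • A.map Polynomial.C)).divX.divX.eval r =
        ∑ k ∈ Finset.range (Fintype.card n + 1),
          (∑ t ∈ Finset.univ.powersetCard (k + 1 + 1),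
            (A.submatrix (Subtype.val : t → n) (Subtype.val : t → n)).det) * r ^ k := by
    have hdeg := Polynomial.natDegree_det_X_add_C_le A 1
    rw [Matrix.map_one _ Polynomial.C_0 Polynomial.C_1, add_comm] at hdeg
    rw [Polynomial.eval_eq_sum_range' (n := Fintype.card n + 1)]
    · simp only [Polynomial.coeff_divX, Matrix.coeff_det_one_add_X_smul_eq_sum_minors]
    · simp only [Polynomial.natDegree_divX_eq_natDegree_tsub_one]
      omega
  have hlim : Tendsto (fun a => (N a).trace +
      (∑ k ∈ Finset.range (Fintype.card n + 1),
        (∑ t ∈ Finset.univ.powersetCard (k + 1 + 1),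
          ((N a).submatrix (Subtype.val : t → n) (Subtype.val : t → n)).det) * s a ^ k) * s a)
      l (nhds B.trace) := by
    have hc : Continuous fun p : Matrix n n ℝ × ℝ => p.1.trace +
      (∑ k ∈ Finset.range (Fintype.card n + 1),
        (∑ t ∈ Finset.univ.powersetCard (k + 1 + 1),
          (p.1.submatrix (Subtype.val : t → n) (Subtype.val : t → n)).det) * p.2 ^ k) * p.2 := by
      have hdet (t : Finset n) : Continuous fun p : Matrix n n ℝ × ℝ =>
          (p.1.submatrix (Subtype.val : t → n) (Subtype.val : t → n)).det :=
        (continuous_fst.matrix_submatrix _ _).matrix_det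
      have htr : Continuous fun p : Matrix n n ℝ × ℝ => p.1.trace :=
        continuous_fst.matrix_trace
      fun_prop
    simpa using! (hc.tendsto (B, 0)).comp (hN.prodMk_nhds hs0)
  refine hlim.congr' ?_
  filter_upwards [hne] with a ha
  rw [Matrix.det_one_add_smul, hq]
  field_simp
  ring

/-- A power series with geometrically bounded coefficients, expanded to second order at `0`. -/
theorem exists_tendsto_tsum_smul_pow_eq {A : Type*} [NormedRing A] [NormedAlgebra ℝ A]
    [CompleteSpace A] {b : ℕ → ℝ} (hb : ∀ n, |b n| ≤ 2 ^ n) (x : A) :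
    ∃ N : ℝ → A, Tendsto N (nhds 0) (nhds (b 2 • x ^ 2)) ∧
      ∀ᶠ T in nhds (0 : ℝ), ∑' n, b n • (T ^ n • x ^ n) =
        b 0 • 1 + (b 1 * T) • x + T ^ 2 • N T := by
  set S : Set ℝ := {T | 2 * |T| * ‖x‖ ≤ 1 / 2}
  have hS : S ∈ nhds (0 : ℝ) := by
    have hc : Continuous fun T : ℝ => 2 * |T| * ‖x‖ := by fun_prop
    exact (hc.tendsto' 0 0 (by simp)).eventually_le_const (by norm_num)
  have hu : Summable fun n : ℕ => (1 / 2 : ℝ) ^ n * (4 * ‖x‖ ^ 2) :=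
    summable_geometric_two.mul_right _
  have hbound (n : ℕ) (T : ℝ) (hT : T ∈ S) :
      ‖b (n + 2) • (T ^ n • x ^ (n + 2))‖ ≤ (1 / 2) ^ n * (4 * ‖x‖ ^ 2) := by
    rw [norm_smul, norm_smul, norm_pow, Real.norm_eq_abs, Real.norm_eq_abs]
    calc |b (n + 2)| * (|T| ^ n * ‖x ^ (n + 2)‖)
        ≤ 2 ^ (n + 2) * (|T| ^ n * ‖x‖ ^ (n + 2)) := by
          gcongr
          · exact hb _
          · exact norm_pow_le' x (by omega)
      _ = (2 * |T| * ‖x‖) ^ n * (4 * ‖x‖ ^ 2) := by ring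
      _ ≤ (1 / 2) ^ n * (4 * ‖x‖ ^ 2) := by
          gcongr
          exact hT
  refine ⟨fun T => ∑' n, b (n + 2) • (T ^ n • x ^ (n + 2)), ?_, ?_⟩
  · have hcont := (continuousOn_tsum (f := fun n T => b (n + 2) • (T ^ n • x ^ (n + 2)))
      (fun n => by fun_prop) hu hbound).continuousAt hS
    have h0 : ∑' n, b (n + 2) • ((0 : ℝ) ^ n • x ^ (n + 2)) = b 2 • x ^ 2 := by
      rw [tsum_eq_single 0 (fun n hn => by simp [hn])]
      simp
    simpa only [ContinuousAt, h0] using hcont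
  · filter_upwards [hS] with T hT
    have hs : Summable fun n => b (n + 2) • (T ^ n • x ^ (n + 2)) :=
      hu.of_norm_bounded fun n => hbound n T hT
    have hterm (n : ℕ) : b (n + 2) • (T ^ (n + 2) • x ^ (n + 2)) =
        T ^ 2 • (b (n + 2) • (T ^ n • x ^ (n + 2))) := by
      simp only [smul_smul]
      congr 1
      ring
    have hs' : Summable fun n => b n • (T ^ n • x ^ n) := by
      rw [← summable_nat_add_iff 2]
      simpa only [hterm] using hs.const_smul (T ^ 2)
    rw [← hs'.sum_add_tsum_nat_add 2, ← hs.tsum_const_smul]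
    simp only [hterm, Finset.sum_range_succ, Finset.sum_range_zero]
    simp [smul_smul]

section MatrixNorm

attribute [local instance] Matrix.linftyOpNormedRing Matrix.linftyOpNormedAlgebra

theorem exists_tendsto_sinhQuotientMatrix_eq {d : ℕ} (Ω : Matrix (Fin d) (Fin d) ℝ) :
    ∃ N : ℝ → Matrix (Fin d) (Fin d) ℝ, Tendsto N (nhds 0) (nhds ((-1 / 24 : ℝ) • Ω ^ 2)) ∧
      ∀ᶠ T in nhds (0 : ℝ), sinhQuotientMatrix Ω T = 1 + T ^ 2 • N T := by
  obtain ⟨N, hN, h⟩ := exists_tendsto_tsum_smul_pow_eq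
    (b := fun n => (((Polynomial.bernoulli n).eval (1 / 2) : ℚ) : ℝ) / (n.factorial : ℝ))
    (fun n => by exact_mod_cast Polynomial.abs_eval_half_bernoulli_div_factorial_le n) Ω
  have h1 : (Polynomial.bernoulli 1).eval (1 / 2 : ℚ) = 0 := by
    norm_num [Polynomial.bernoulli_one]
  have h2 : (Polynomial.bernoulli 2).eval (1 / 2 : ℚ) = -1 / 12 := by
    have := Polynomial.eval_bernoulli_div_factorial 2 (1 / 2)
    norm_num [Finset.sum_range_succ, Nat.factorial, h1] at this
    linarith
  refine ⟨N, ?_, ?_⟩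
  · convert! hN using 3
    rw [h2]
    norm_num [Nat.factorial]
  · filter_upwards [h] with T hT
    refine Eq.trans hT ?_
    rw [h1]
    simp

end MatrixNorm

/-- For a real skew-symmetric `d × d` matrix `Ω`, as `T → 0`,
`√(det (T·Ω / (2 sinh (T·Ω / 2)))) = 1 + (T²/48)·∑_{i,j} Ω_{ij}² + o(T²)`; that is,
`(√(det M(T)) - 1)/T² → (1/48)·∑_{i,j} Ω_{ij}²`, and this limit equals `-(1/48)·tr(Ω²)`. -/
theorem sqrt_det_sinh_quotient_expansion (d : ℕ) (hd : 1 ≤ d)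
    (Ω : Matrix (Fin d) (Fin d) ℝ) (hΩ : Ωᵀ = -Ω) :
    Tendsto (fun T : ℝ => (Real.sqrt (sinhQuotientMatrix Ω T).det - 1) / T ^ 2)
        (nhdsWithin 0 {0}ᶜ)
        (nhds ((1 / 48) * ∑ i : Fin d, ∑ j : Fin d, (Ω i j) ^ 2)) ∧
      (1 / 48 : ℝ) * ∑ i : Fin d, ∑ j : Fin d, (Ω i j) ^ 2 =
        -(1 / 48) * Matrix.trace (Ω ^ 2) := by
  have htr : (1 / 48 : ℝ) * ∑ i : Fin d, ∑ j : Fin d, (Ω i j) ^ 2 =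
      -(1 / 48) * Matrix.trace (Ω ^ 2) := by
    have hji (i j : Fin d) : Ω j i = -Ω i j := congrFun (congrFun hΩ i) j
    have hij (i j : Fin d) : Ω i j ^ 2 = -(Ω i j * Ω j i) := by
      rw [hji i j]
      ring
    simp only [hij, pow_two Ω, Matrix.trace, Matrix.diag_apply, Matrix.mul_apply,
      Finset.sum_neg_distrib]
    ring
  refine ⟨?_, htr⟩
  obtain ⟨N, hN, hM⟩ := exists_tendsto_sinhQuotientMatrix_eq Ω
  have hsq : Tendsto (fun T : ℝ => T ^ 2) (nhdsWithin 0 {0}ᶜ) (nhdsWithin 0 {0}ᶜ) := by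
    refine tendsto_nhdsWithin_iff.mpr ⟨?_, ?_⟩
    · exact ((continuous_pow 2).tendsto' 0 0 (by simp)).mono_left nhdsWithin_le_nhds
    · filter_upwards [self_mem_nhdsWithin] with T hT
      exact pow_ne_zero 2 hT
  have hquot : Tendsto (fun T => ((sinhQuotientMatrix Ω T).det - 1) / T ^ 2)
      (nhdsWithin 0 {0}ᶜ) (nhds ((-1 / 24 : ℝ) • Ω ^ 2).trace) := by
    refine (Matrix.tendsto_det_one_add_sub_one_div hsq
      (hN.mono_left nhdsWithin_le_nhds)).congr' ?_
    filter_upwards [nhdsWithin_le_nhds hM] with T hT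
    rw [hT]
  have hdet : Tendsto (fun T => (sinhQuotientMatrix Ω T).det) (nhdsWithin 0 {0}ᶜ) (nhds 1) := by
    have := (hquot.mul (hsq.mono_right nhdsWithin_le_nhds)).add_const 1
    rw [mul_zero, zero_add] at this
    refine this.congr' ?_
    filter_upwards [self_mem_nhdsWithin] with T hT
    have hT : T ≠ 0 := hT
    field_simp
    ring
  have hsqrt := (hdet.sqrt).add_const 1
  have hfinal := hquot.div hsqrt (by simp)
  have hval : ((-1 / 24 : ℝ) • Ω ^ 2).trace / (√1 + 1) =
      (1 / 48) * ∑ i : Fin d, ∑ j : Fin d, (Ω i j) ^ 2 := by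
    rw [htr, Matrix.trace_smul, Real.sqrt_one, smul_eq_mul]
    ring
  rw [hval] at hfinal
  refine hfinal.congr' ?_
  filter_upwards [hdet.eventually_const_lt one_pos] with T hT
  have hpos : √(sinhQuotientMatrix Ω T).det + 1 ≠ 0 := by positivity
  rw [Pi.div_apply, div_right_comm]
  congr 1
  rw [div_eq_iff hpos]
  nlinarith [Real.sq_sqrt hT.le]
end
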